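/- arXiv:2602.09885 — 3 statements merged into one kernel-verified Lean document; each statement's English description precedes it below -/
import Mathlib

section
/- Let X be a cosimplicial k-algebra such that each algebra X^n is commutative. Then the cup product on the quotient X_N/Ĵ_X is graded commutative: for every f ∈ X_N^p and g ∈ X_N^q one has f ∪ g − (−1)^{pq} g ∪ f ∈ Ĵ_X. -/
/-! Statement 3: for a degreewise-commutative cosimplicial algebra, the cup product is graded
commutative modulo the differentiating ideal `Ĵ_X`. -/

universe u v

/-- A cosimplicial `k`-algebra: `k`-algebras `X^n` with cofaces
`d^i : X^n → X^{n+1}` (`0 ≤ i ≤ n+1`) and codegeneracies `s^j : X^{n+1} → X^n` (`0 ≤ j ≤ n`)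
which are algebra homomorphisms; the cosimplicial identities are required in
`CoSA.IsCosimplicial` below. -/
structure CoSA (k : Type u) [Field k] where
  X : ℕ → Type v
  ring : ∀ n, Ring (X n)
  alg : ∀ n, Algebra k (X n)
  d : (n : ℕ) → ℕ → (X n →ₐ[k] X (n + 1))
  s : (n : ℕ) → ℕ → (X (n + 1) →ₐ[k] X n)

attribute [instance] CoSA.ring CoSA.alg

variable {k : Type u} [Field k]

namespace CoSA

/-- The cosimplicial identities. -/
def IsCosimplicial (A : CoSA k) : Prop :=
  (∀ n i j, i < j → j ≤ n + 2 →
    (A.d (n + 1) j).comp (A.d n i) = (A.d (n + 1) i).comp (A.d n (j - 1))) ∧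
  (∀ n i j, i ≤ j → j ≤ n →
    (A.s n j).comp (A.s (n + 1) i) = (A.s n i).comp (A.s (n + 1) (j + 1))) ∧
  (∀ n i j, i < j → j ≤ n + 1 →
    (A.s (n + 1) j).comp (A.d (n + 1) i) = (A.d n i).comp (A.s n (j - 1))) ∧
  (∀ n j, j ≤ n → (A.s n j).comp (A.d n j) = AlgHom.id k (A.X n)) ∧
  (∀ n j, j ≤ n → (A.s n j).comp (A.d n (j + 1)) = AlgHom.id k (A.X n)) ∧
  (∀ n i j, j + 1 < i → i ≤ n + 2 →
    (A.s (n + 1) j).comp (A.d (n + 1) i) = (A.d n (i - 1)).comp (A.s n j))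

/-- Cast along an equality of degrees. -/
def xc (A : CoSA k) {a b : ℕ} (h : a = b) : A.X a →ₗ[k] A.X b := by
  subst h; exact LinearMap.id

/-- The normalized part `X_N^n = ⋂_{j=1}^n ker (s^{j-1} : X^n → X^{n-1})`. -/
def N (A : CoSA k) (n : ℕ) : Submodule k (A.X n) :=
  ⨅ (m : ℕ) (h : n = m + 1) (j : Fin (m + 1)),
    LinearMap.ker ((A.s m j).toLinearMap.comp (A.xc h))

/-- The simplicial coboundary `δ = Σ_{i=0}^{n+1} (-1)^i d^i : X^n → X^{n+1}`. -/
noncomputable def delta (A : CoSA k) (n : ℕ) : A.X n →ₗ[k] A.X (n + 1) :=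
  ∑ i ∈ Finset.range (n + 2), ((-1 : ℤ) ^ i) • (A.d n i).toLinearMap

/-- Iterated coface `(d^i)^m : X^p → X^{p+m}` (the index `i` is fixed). -/
noncomputable def dIter (A : CoSA k) (i p : ℕ) : (m : ℕ) → (A.X p →ₗ[k] A.X (p + m))
  | 0 => LinearMap.id
  | (m + 1) => (A.d (p + m) i).toLinearMap.comp (A.dIter i p m)

/-- The cup product `f ∪ g = (d^{p+1})^q(f) · (d^0)^p(g)` for `f ∈ X^p`, `g ∈ X^q`. -/
noncomputable def cup (A : CoSA k) (p q : ℕ) : A.X p →ₗ[k] A.X q →ₗ[k] A.X (p + q) :=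
  (LinearMap.mul k (A.X (p + q))).compl₁₂ (A.dIter (p + 1) p q)
    ((A.xc (Nat.add_comm q p)).comp (A.dIter 0 q p))

/-- The ideal `I_{n+1,j+1} = ker (s^j : X^{n+1} → X^n)`, as a submodule. -/
def Isub (A : CoSA k) (n : ℕ) (j : Fin (n + 1)) : Submodule k (A.X (n + 1)) :=
  LinearMap.ker (A.s n j).toLinearMap

/-- The higher-vanishing ideal `J_X^n = Σ_{j=1}^n (I_{n,j}·I_{n,j} ∩ X_N^n)` (and `0` for `n = 0`). -/
def Jsub (A : CoSA k) (n : ℕ) : Submodule k (A.X n) :=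
  ⨆ (m : ℕ) (h : n = m + 1) (j : Fin (m + 1)),
    Submodule.map (A.xc h.symm) ((A.Isub m j * A.Isub m j) ⊓ A.N (m + 1))

/-- The differentiating ideal `Ĵ_X = J_X + δ(J_X)`. -/
noncomputable def Jhat (A : CoSA k) (n : ℕ) : Submodule k (A.X n) :=
  A.Jsub n ⊔ ⨆ (m : ℕ) (h : n = m + 1), (A.Jsub m).map ((A.xc h.symm).comp (A.delta m))

end CoSA
namespace CoSA

def dd (i x : ℕ) : ℕ := if x < i then x else x + 1
def ss (j x : ℕ) : ℕ := if x ≤ j then x else x - 1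

def V (p n : ℕ) (φ : ℕ → ℕ) : Prop := (∀ a b, a ≤ b → b ≤ p → φ a ≤ φ b) ∧ φ p ≤ n

/-- decalage -/
abbrev Dec (A : CoSA k) : CoSA k where
  X n := A.X (n + 1)
  ring n := A.ring (n + 1)
  alg n := A.alg (n + 1)
  d n i := A.d (n + 1) i
  s n j := A.s (n + 1) j

theorem Dec_cos {A : CoSA k} (hA : A.IsCosimplicial) : A.Dec.IsCosimplicial := by
  obtain ⟨h1, h2, h3, h4, h5, h6⟩ := hA
  exact ⟨fun n i j h h' => h1 (n + 1) i j h (by omega), fun n i j h h' => h2 (n + 1) i j h (by omega),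
    fun n i j h h' => h3 (n + 1) i j h (by omega), fun n j h => h4 (n + 1) j (by omega),
    fun n j h => h5 (n + 1) j (by omega), fun n i j h h' => h6 (n + 1) i j h (by omega)⟩

noncomputable def act : (p n : ℕ) → (A : CoSA k) → (ℕ → ℕ) → (A.X p →ₐ[k] A.X n)
  | 0, 0, A, _ => AlgHom.id k (A.X 0)
  | p + 1, 0, A, φ => (act p 0 A φ).comp (A.s p p)
  | 0, n + 1, A, φ =>
      if φ 0 ≤ n then (A.d n (n + 1)).comp (act 0 n A φ)
      else (A.d n 0).comp (act 0 n A (fun _ => n))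
  | p + 1, n + 1, A, φ =>
      if φ (p + 1) ≤ n then (A.d n (n + 1)).comp (act (p + 1) n A φ)
      else if n + 1 ≤ φ p then (act p (n + 1) A φ).comp (A.s p p)
      else act p n A.Dec φ
termination_by p n => p + n

theorem act_lt {A : CoSA k} {p n : ℕ} {φ : ℕ → ℕ} (h : φ p ≤ n) :
    act p (n + 1) A φ = (A.d n (n + 1)).comp (act p n A φ) := by
  cases p <;> rw [act] <;> simp [h]

theorem act_zero {A : CoSA k} {n : ℕ} {φ : ℕ → ℕ} (h : φ 0 = n + 1) :
    act 0 (n + 1) A φ = (A.d n 0).comp (act 0 n A (fun _ => n)) := by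
  rw [act, if_neg (by omega)]

theorem act_s {A : CoSA k} {p n : ℕ} {φ : ℕ → ℕ} (h : φ (p + 1) = n) (h' : φ p = n) :
    act (p + 1) n A φ = (act p n A φ).comp (A.s p p) := by
  cases n
  · rw [act]
  · rw [act, if_neg (by omega), if_pos (by omega)]

theorem act_dec {A : CoSA k} {p n : ℕ} {φ : ℕ → ℕ} (h : φ (p + 1) = n + 1) (h' : φ p ≤ n) :
    act (p + 1) (n + 1) A φ = act p n A.Dec φ := by
  rw [act, if_neg (by omega), if_neg (by omega)]

theorem V.succ {p n : ℕ} {φ : ℕ → ℕ} (h : V (p + 1) n φ) : V p n φ :=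
  ⟨fun a b hab hb => h.1 a b hab (by omega), (h.1 p (p + 1) (by omega) le_rfl).trans h.2⟩

/-- induction principle following the definition of `act` -/
theorem act_induct
    (P : (p n : ℕ) → CoSA.{u, v} k → (ℕ → ℕ) → Prop)
    (h00 : ∀ A φ, V 0 0 φ → P 0 0 A φ)
    (hd : ∀ p n A φ, V p (n + 1) φ → φ p ≤ n → V p n φ → P p n A φ → P p (n + 1) A φ)
    (h0 : ∀ n A φ, V 0 (n + 1) φ → φ 0 = n + 1 → P 0 n A (fun _ => n) → P 0 (n + 1) A φ)
    (hs : ∀ p n A φ, V (p + 1) n φ → φ (p + 1) = n → φ p = n → V p n φ → P p n A φ →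
      P (p + 1) n A φ)
    (hdec : ∀ p n A φ, V (p + 1) (n + 1) φ → φ (p + 1) = n + 1 → φ p ≤ n → V p n φ →
      P p n A.Dec φ → P (p + 1) (n + 1) A φ) :
    ∀ p n A φ, V p n φ → P p n A φ := by
  intro p n
  induction hN : p + n using Nat.strong_induction_on generalizing p n with
  | _ N ih =>
  subst hN
  intro A φ hV
  rcases n with _ | n
  · rcases p with _ | p
    · exact h00 A φ hV
    · have h1 := hV.2
      have h2 := hV.succ.2
      exact hs p 0 A φ hV (by omega) (by omega) hV.succ (ih _ (by omega) _ _ rfl _ _ hV.succ)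
  · by_cases h : φ p ≤ n
    · exact hd p n A φ hV h ⟨hV.1, h⟩ (ih _ (by omega) _ _ rfl _ _ ⟨hV.1, h⟩)
    · have h1 := hV.2
      rcases p with _ | p
      · exact h0 n A φ hV (by omega)
          (ih _ (by omega) _ _ rfl _ _ ⟨fun _ _ _ _ => le_rfl, le_rfl⟩)
      · have h2 := hV.succ.2
        by_cases h' : φ p ≤ n
        · exact hdec p n A φ hV (by omega) h' ⟨hV.succ.1, h'⟩
            (ih _ (by omega) _ _ rfl _ _ ⟨hV.succ.1, h'⟩)
        · exact hs p (n + 1) A φ hV (by omega) (by omega) hV.succ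
            (ih _ (by omega) _ _ rfl _ _ hV.succ)

theorem act_congr (p n : ℕ) (A : CoSA.{u, v} k) (φ : ℕ → ℕ) (hV : V p n φ) :
    ∀ ψ : ℕ → ℕ, (∀ a, a ≤ p → φ a = ψ a) → act p n A φ = act p n A ψ := by
  revert p n A φ hV
  apply act_induct
  · intro A φ hV ψ h; rw [act, act]
  · intro p n A φ hV h1 hV' ih ψ h
    rw [act_lt h1, act_lt (by rw [← h p le_rfl]; exact h1), ih ψ h]
  · intro n A φ hV h1 ih ψ h
    rw [act_zero h1, act_zero (by rw [← h 0 le_rfl]; exact h1)]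
  · intro p n A φ hV h1 h2 hV' ih ψ h
    rw [act_s h1 h2, act_s (by rw [← h _ le_rfl]; exact h1) (by rw [← h _ (by omega)]; exact h2),
      ih ψ (fun a ha => h a (by omega))]
  · intro p n A φ hV h1 h2 hV' ih ψ h
    rw [act_dec h1 h2, act_dec (by rw [← h _ le_rfl]; exact h1) (by rw [← h _ (by omega)]; exact h2),
      ih ψ (fun a ha => h a (by omega))]

theorem act_id (n : ℕ) : ∀ A : CoSA.{u, v} k, act n n A id = AlgHom.id k (A.X n) := by
  induction n with
  | zero => intro A; rw [act]
  | succ n ih => intro A; rw [act_dec (φ := id) rfl le_rfl, ih]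

theorem act_d (p n : ℕ) (A : CoSA.{u, v} k) (φ : ℕ → ℕ) (hV : V p n φ) :
    A.IsCosimplicial → ∀ i, i ≤ n + 1 →
      act p (n + 1) A (dd i ∘ φ) = (A.d n i).comp (act p n A φ) := by
  -- the top coface
  have top : ∀ (p n : ℕ) (A : CoSA.{u, v} k) (φ : ℕ → ℕ), V p n φ →
      act p (n + 1) A (dd (n + 1) ∘ φ) = (A.d n (n + 1)).comp (act p n A φ) := by
    intro p n A φ hV
    have h2 := hV.2
    have e : ∀ a, a ≤ p → φ a = (dd (n + 1) ∘ φ) a := by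
      intro a ha
      have := hV.1 a p ha le_rfl
      simp only [Function.comp, dd]
      grind
    rw [act_lt (by rw [← e p le_rfl]; exact h2), act_congr p n A φ hV _ e]
  revert p n A φ hV
  apply act_induct
  · intro A φ hV hA i hi
    have h2 := hV.2
    rcases Nat.lt_or_ge i 1 with h | h
    · obtain rfl : i = 0 := by omega
      rw [act_zero (by simp [dd]; grind), act, act]
    · obtain rfl : i = 1 := by omega
      exact top 0 0 A φ hV
  · intro p n A φ hV h1 hV' ih hA i hi
    rcases Nat.lt_or_ge i (n + 2) with h | h
    swap
    · obtain rfl : i = n + 2 := by omega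
      exact top _ _ A φ hV
    rw [act_lt (by simp [dd]; grind), act_lt h1, ih hA i (by omega), ← AlgHom.comp_assoc,
      ← AlgHom.comp_assoc, hA.1 n i (n + 2) (by omega) (by omega)]
    rfl
  · intro n A φ hV h1 ih hA i hi
    rcases Nat.lt_or_ge i (n + 2) with h | h
    swap
    · obtain rfl : i = n + 2 := by omega
      exact top _ _ A φ hV
    rw [act_zero (by simp [dd]; grind), act_zero h1]
    have key : ∀ j, j ≤ n → act 0 (n + 1) A (fun _ => n + 1)
        = (A.d n j).comp (act 0 n A (fun _ => n)) := by
      intro j hj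
      rw [← ih hA j (by omega)]
      apply act_congr
      · exact ⟨fun _ _ _ _ => le_rfl, le_rfl⟩
      · intro a ha; simp [dd]; grind
    rcases i with _ | i
    · rw [key 0 (by omega)]
    · rw [key i (by omega), ← AlgHom.comp_assoc, ← AlgHom.comp_assoc,
        hA.1 n 0 (i + 1) (by omega) (by omega)]
      rfl
  · intro p n A φ hV h1 h2 hV' ih hA i hi
    rcases Nat.lt_or_ge i (n + 1) with h | h
    swap
    · obtain rfl : i = n + 1 := by omega
      exact top _ _ A φ hV
    rw [act_s (by simp [dd]; grind) (by simp [dd]; grind), act_s h1 h2, ih hA i hi,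
      AlgHom.comp_assoc]
  · intro p n A φ hV h1 h2 hV' ih hA i hi
    rcases Nat.lt_or_ge i (n + 2) with h | h
    swap
    · obtain rfl : i = n + 2 := by omega
      exact top _ _ A φ hV
    rw [act_dec (by simp [dd]; grind) (by simp [dd]; grind), act_dec h1 h2,
      ih (Dec_cos hA) i (by omega)]

theorem act_nat (p n : ℕ) (A : CoSA.{u, v} k) (φ : ℕ → ℕ) (hV : V p n φ) :
    ∀ (B : CoSA.{u, v} k) (η : ∀ n, A.X n →ₐ[k] B.X n),
      (∀ n i, i ≤ n + 1 → (η (n + 1)).comp (A.d n i) = (B.d n i).comp (η n)) →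
      (∀ n j, j ≤ n → (η n).comp (A.s n j) = (B.s n j).comp (η (n + 1))) →
      (η n).comp (act p n A φ) = (act p n B φ).comp (η p) := by
  revert p n A φ hV
  apply act_induct
  · intro A φ hV B η hd hs; rw [act, act]; rfl
  · intro p n A φ hV h1 hV' ih B η hd hs
    rw [act_lt h1, act_lt h1, ← AlgHom.comp_assoc, hd _ _ le_rfl, AlgHom.comp_assoc,
      ih B η hd hs, AlgHom.comp_assoc]
  · intro n A φ hV h1 ih B η hd hs
    rw [act_zero h1, act_zero h1, ← AlgHom.comp_assoc, hd _ _ (by omega), AlgHom.comp_assoc,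
      ih B η hd hs, AlgHom.comp_assoc]
  · intro p n A φ hV h1 h2 hV' ih B η hd hs
    rw [act_s h1 h2, act_s h1 h2, ← AlgHom.comp_assoc, ih B η hd hs, AlgHom.comp_assoc,
      hs _ _ le_rfl, AlgHom.comp_assoc]
  · intro p n A φ hV h1 h2 hV' ih B η hd hs
    rw [act_dec h1 h2, act_dec h1 h2]
    exact ih B.Dec (fun n => η (n + 1)) (fun n i hi => hd (n + 1) i (by omega))
      (fun n j hj => hs (n + 1) j (by omega))

theorem act_last (p n : ℕ) (A : CoSA.{u, v} k) (φ : ℕ → ℕ) (hV : V p n φ) :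
    A.IsCosimplicial → φ p = n →
      (A.s n n).comp (act p n A.Dec φ) = (act p n A φ).comp (A.s p p) := by
  revert p n A φ hV
  apply act_induct
  · intro A φ hV hA h; rw [act, act]; rfl
  · intro p n A φ hV h1 hV' ih hA h; omega
  · intro n A φ hV h1 ih hA h
    rw [act_zero h1, act_zero h1, AlgHom.comp_assoc, ← ih hA rfl, ← AlgHom.comp_assoc,
      ← AlgHom.comp_assoc]
    congr 1
    exact hA.2.2.1 n 0 (n + 1) (by omega) (by omega)
  · intro p n A φ hV h1 h2 hV' ih hA h
    rw [act_s h1 h2, act_s h1 h2, ← AlgHom.comp_assoc, ih hA h2, AlgHom.comp_assoc,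
      AlgHom.comp_assoc]
    congr 1
    exact hA.2.1 p p p le_rfl le_rfl
  · intro p n A φ hV h1 h2 hV' ih hA h
    rw [act_dec h1 h2, act_dec h1 h2]
    refine act_nat p n A.Dec.Dec φ hV' A.Dec (fun n => A.s (n + 1) (n + 1)) ?_ ?_
    · intro n i hi
      exact hA.2.2.1 (n + 1) i (n + 2) (by omega) (by omega)
    · intro n j hj
      exact hA.2.1 (n + 1) j (n + 1) (by omega) (by omega)

theorem act_ss (p m : ℕ) (A : CoSA.{u, v} k) (φ : ℕ → ℕ) (hV : V p m φ) :
    A.IsCosimplicial → ∀ n, (h : m = n + 1) → ∀ j, j ≤ n →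
      (A.s n j).comp (act p (n + 1) A φ) = act p n A (ss j ∘ φ) := by
  revert p m A φ hV
  apply act_induct
  · intro A φ hV hA n h; omega
  · intro p m A φ hV h1 hV' ih hA n h j hj
    obtain rfl : m = n := by omega
    rw [act_lt h1, ← AlgHom.comp_assoc]
    rcases Nat.lt_or_ge j m with hj' | hj'
    · obtain ⟨n, rfl⟩ : ∃ n, m = n + 1 := ⟨m - 1, by omega⟩
      rw [hA.2.2.2.2.2 n (n + 2) j (by omega) (by omega), AlgHom.comp_assoc, ih hA n rfl j (by omega),
        act_lt (by simp [ss]; grind)]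
      rfl
    · obtain rfl : m = j := by omega
      rw [hA.2.2.2.2.1 m m le_rfl, AlgHom.id_comp]
      apply act_congr _ _ _ _ hV'
      intro a ha
      have := hV'.1 a p ha le_rfl
      simp [ss]; grind
  · intro m A φ hV h1 ih hA n h j hj
    obtain rfl : m = n := by omega
    rw [act_zero h1, ← AlgHom.comp_assoc]
    rcases j with _ | j
    · rw [hA.2.2.2.1 m 0 (by omega), AlgHom.id_comp]
      apply act_congr
      · exact ⟨fun _ _ _ _ => le_rfl, le_rfl⟩
      · intro a ha; simp [ss]; grind
    · obtain ⟨n, rfl⟩ : ∃ n, m = n + 1 := ⟨m - 1, by omega⟩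
      rw [hA.2.2.1 n 0 (j + 1) (by omega) (by omega), AlgHom.comp_assoc, Nat.add_sub_cancel,
        ih hA n rfl j (by omega), act_zero (by simp [ss]; grind)]
      congr 1
      symm
      apply act_congr
      · exact ⟨fun _ _ _ _ => le_rfl, le_rfl⟩
      · intro a ha; simp [ss]; grind
  · intro p m A φ hV h1 h2 hV' ih hA n h j hj
    rw [act_s (by omega) (by omega), ← AlgHom.comp_assoc, ih hA n h j hj,
      act_s (by simp [ss]; grind) (by simp [ss]; grind)]
  · intro p m A φ hV h1 h2 hV' ih hA n h j hj
    obtain rfl : m = n := by omega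
    rw [act_dec h1 h2]
    rcases Nat.lt_or_ge j m with hj' | hj'
    · obtain ⟨n, rfl⟩ : ∃ n, m = n + 1 := ⟨m - 1, by omega⟩
      rw [act_dec (by simp [ss]; grind) (by simp [ss]; grind)]
      exact ih (Dec_cos hA) n rfl j (by omega)
    · obtain rfl : m = j := by omega
      have e : ∀ a, a ≤ p → φ a = (ss m ∘ φ) a := by
        intro a ha
        have := hV'.1 a p ha le_rfl
        simp [ss]; grind
      rcases Nat.lt_or_ge (φ p) m with h3 | h3
      · obtain ⟨n, rfl⟩ : ∃ n, m = n + 1 := ⟨m - 1, by omega⟩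
        rw [act_lt (by omega), act_dec (by simp [ss]; grind) (by simp [ss]; grind)]
        rw [← act_congr p n A.Dec φ ⟨hV'.1, by omega⟩ _ e, ← AlgHom.comp_assoc]
        have := hA.2.2.2.1 (n + 1) (n + 1) le_rfl
        change ((A.s (n + 1) (n + 1)).comp (A.d (n + 1) (n + 1))).comp _ = _
        rw [this]
        rfl
      · rw [act_last p m A φ hV' hA (by omega), act_s (by simp [ss]; grind) (by simp [ss]; grind),
          act_congr p m A φ hV' _ e]

inductive Rep (A : CoSA.{u, v} k) (p : ℕ) : (n : ℕ) → (ℕ → ℕ) → (A.X p →ₐ[k] A.X n) → Prop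
  | id : Rep A p p id (AlgHom.id k (A.X p))
  | d (n i : ℕ) (φ : ℕ → ℕ) (F : A.X p →ₐ[k] A.X n) (hi : i ≤ n + 1)
      (h : Rep A p n φ F) : Rep A p (n + 1) (dd i ∘ φ) ((A.d n i).comp F)
  | s (n j : ℕ) (φ : ℕ → ℕ) (F : A.X p →ₐ[k] A.X (n + 1)) (hi : j ≤ n)
      (h : Rep A p (n + 1) φ F) : Rep A p n (ss j ∘ φ) ((A.s n j).comp F)

theorem dd_mono (i : ℕ) {a b : ℕ} (h : a ≤ b) : dd i a ≤ dd i b := by simp only [dd]; grind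
theorem ss_mono (i : ℕ) {a b : ℕ} (h : a ≤ b) : ss i a ≤ ss i b := by simp only [ss]; grind

theorem Rep.valid {A : CoSA.{u, v} k} {p n : ℕ} {φ : ℕ → ℕ} {F : A.X p →ₐ[k] A.X n}
    (h : Rep A p n φ F) : V p n φ := by
  induction h with
  | id => exact ⟨fun _ _ h _ => h, le_rfl⟩
  | d n i φ F hi h ih =>
    exact ⟨fun a b h1 h2 => dd_mono _ (ih.1 a b h1 h2), by have := ih.2; simp [dd]; grind⟩
  | s n i φ F hi h ih =>
    exact ⟨fun a b h1 h2 => ss_mono _ (ih.1 a b h1 h2), by have := ih.2; simp [ss]; grind⟩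

theorem Rep.eq {A : CoSA.{u, v} k} {p n : ℕ} {φ : ℕ → ℕ} {F : A.X p →ₐ[k] A.X n}
    (h : Rep A p n φ F) (hA : A.IsCosimplicial) : act p n A φ = F := by
  induction h with
  | id => exact act_id p A
  | d n i φ F hi h ih => rw [act_d p n A φ h.valid hA i hi, ih]
  | s n i φ F hi h ih => rw [← act_ss p (n + 1) A φ h.valid hA n rfl i hi, ih]

theorem Rep.comp {A : CoSA.{u, v} k} {p m n : ℕ} {φ ψ : ℕ → ℕ} {F : A.X p →ₐ[k] A.X m}
    {G : A.X m →ₐ[k] A.X n} (hG : Rep A m n ψ G) (hF : Rep A p m φ F) :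
    Rep A p n (ψ ∘ φ) (G.comp F) := by
  induction hG with
  | id => exact hF
  | d n i ψ G hi h ih => exact Rep.d n i _ _ hi ih
  | s n i ψ G hi h ih => exact Rep.s n i _ _ hi ih

theorem Rep.ofDec {A : CoSA.{u, v} k} {p n : ℕ} {φ : ℕ → ℕ} {F : A.Dec.X p →ₐ[k] A.Dec.X n}
    (h : Rep A.Dec p n φ F) : φ (p + 1) = n + 1 ∧ Rep A (p + 1) (n + 1) φ F := by
  induction h with
  | id => exact ⟨rfl, Rep.id⟩
  | d n i φ F hi h ih =>
    obtain ⟨h1, h3⟩ := ih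
    exact ⟨by simp [dd]; grind, Rep.d _ i _ _ (by omega) h3⟩
  | s n i φ F hi h ih =>
    obtain ⟨h1, h3⟩ := ih
    exact ⟨by simp [ss]; grind, Rep.s _ i _ _ (by omega) h3⟩

theorem exists_rep (p n : ℕ) (A : CoSA.{u, v} k) (φ : ℕ → ℕ) (hV : V p n φ) :
    ∃ χ : ℕ → ℕ, (∀ a, a ≤ p → φ a = χ a) ∧ Rep A p n χ (act p n A φ) := by
  revert p n A φ hV
  apply act_induct
  · intro A φ hV
    refine ⟨_, ?_, by rw [act]; exact Rep.id⟩
    intro a ha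
    obtain rfl : a = 0 := by omega
    have := hV.2
    simp; omega
  · intro p n A φ hV h1 hV' ⟨χ, h2, h3⟩
    rw [act_lt h1]
    refine ⟨_, ?_, Rep.d _ _ _ _ (by omega) h3⟩
    intro a ha
    have := hV'.1 a p ha le_rfl
    have := h2 a ha
    simp [dd]; grind
  · intro n A φ hV h1 ⟨χ, h2, h3⟩
    rw [act_zero h1]
    refine ⟨_, ?_, Rep.d _ _ _ _ (by omega) h3⟩
    intro a ha
    have := h2 a ha
    obtain rfl : a = 0 := by omega
    simp [dd]; grind
  · intro p n A φ hV h1 h2 hV' ⟨χ, h3, h4⟩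
    rw [act_s h1 h2]
    refine ⟨_, ?_, h4.comp (Rep.s _ p _ _ (by omega) Rep.id)⟩
    intro a ha
    simp only [Function.comp, ss, id]
    split_ifs with h
    · exact h3 a h
    · obtain rfl : a = p + 1 := by omega
      rw [Nat.add_sub_cancel, ← h3 p le_rfl]; omega
  · intro p n A φ hV h1 h2 hV' ⟨χ, h3, h4⟩
    rw [act_dec h1 h2]
    refine ⟨χ, ?_, h4.ofDec.2⟩
    intro a ha
    rcases Nat.lt_or_ge p a with h | h
    · obtain rfl : a = p + 1 := by omega
      rw [h4.ofDec.1]; omega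
    · exact h3 a h

theorem V.comp {p m n : ℕ} {φ ψ : ℕ → ℕ} (h2 : V m n ψ) (h1 : V p m φ) : V p n (ψ ∘ φ) :=
  ⟨fun a b h h' => h2.1 _ _ (h1.1 a b h h') ((h1.1 b p h' le_rfl).trans h1.2),
    (h2.1 _ _ h1.2 le_rfl).trans h2.2⟩

theorem act_comp {A : CoSA.{u, v} k} (hA : A.IsCosimplicial) {p m n : ℕ} {φ ψ : ℕ → ℕ}
    (h1 : V p m φ) (h2 : V m n ψ) (x : A.X p) :
    act m n A ψ (act p m A φ x) = act p n A (ψ ∘ φ) x := by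
  obtain ⟨χ, a1, a2⟩ := exists_rep p m A φ h1
  obtain ⟨ω, b1, b2⟩ := exists_rep m n A ψ h2
  rw [act_congr p n A (ψ ∘ φ) (h2.comp h1) (ω ∘ χ), (b2.comp a2).eq hA]
  · rfl
  · intro a ha
    simp only [Function.comp]
    rw [b1, a1 a ha]
    exact (h1.1 a p ha le_rfl).trans h1.2

theorem V_id {p n : ℕ} (h : p ≤ n) : V p n id := ⟨fun _ _ h _ => h, h⟩

theorem V_dd {n i : ℕ} (hi : i ≤ n + 1) : V n (n + 1) (dd i) :=
  ⟨fun _ _ h _ => dd_mono i h, by simp only [dd]; grind⟩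

theorem V_ss {n i : ℕ} (hi : i ≤ n) : V (n + 1) n (ss i) :=
  ⟨fun _ _ h _ => ss_mono i h, by simp only [ss]; grind⟩

theorem d_act {A : CoSA.{u, v} k} (hA : A.IsCosimplicial) {p n i : ℕ} {φ : ℕ → ℕ}
    (hV : V p n φ) (hi : i ≤ n + 1) (x : A.X p) :
    A.d n i (act p n A φ x) = act p (n + 1) A (dd i ∘ φ) x := by
  rw [act_d p n A φ hV hA i hi]; rfl

theorem s_act {A : CoSA.{u, v} k} (hA : A.IsCosimplicial) {p n i : ℕ} {φ : ℕ → ℕ}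
    (hV : V p (n + 1) φ) (hi : i ≤ n) (x : A.X p) :
    A.s n i (act p (n + 1) A φ x) = act p n A (ss i ∘ φ) x := by
  rw [← act_ss p (n + 1) A φ hV hA n rfl i hi]; rfl

theorem act_id_apply {A : CoSA.{u, v} k} {n : ℕ} (x : A.X n) : act n n A id x = x := by
  rw [act_id]; rfl

theorem act_dd {A : CoSA.{u, v} k} (hA : A.IsCosimplicial) {n i : ℕ}
    (hi : i ≤ n + 1) (x : A.X n) : A.d n i x = act n (n + 1) A (dd i) x := by
  conv_lhs => rw [← act_id_apply x, d_act hA (V_id le_rfl) hi]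
  rfl

theorem act_ssg {A : CoSA.{u, v} k} (hA : A.IsCosimplicial) {n i : ℕ}
    (hi : i ≤ n) (x : A.X (n + 1)) : A.s n i x = act (n + 1) n A (ss i) x := by
  conv_lhs => rw [← act_id_apply x, s_act hA (V_id le_rfl) hi]
  rfl

theorem act_pre_d {A : CoSA.{u, v} k} (hA : A.IsCosimplicial) {p n i : ℕ} {φ : ℕ → ℕ}
    (hV : V (p + 1) n φ) (hi : i ≤ p + 1) (x : A.X p) :
    act (p + 1) n A φ (A.d p i x) = act p n A (φ ∘ dd i) x := by
  rw [act_dd hA hi, act_comp hA (V_dd hi) hV]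

theorem act_ext {A : CoSA.{u, v} k} {p n : ℕ} {φ ψ : ℕ → ℕ}
    (hV : V p n φ) (h : ∀ a, a ≤ p → φ a = ψ a) (x : A.X p) :
    act p n A φ x = act p n A ψ x := by
  rw [act_congr p n A φ hV ψ h]

theorem mem_N_succ {A : CoSA.{u, v} k} {m : ℕ} {x : A.X (m + 1)} :
    x ∈ A.N (m + 1) ↔ ∀ j, j ≤ m → A.s m j x = 0 := by
  simp only [N, Submodule.mem_iInf, LinearMap.mem_ker]
  constructor
  · intro h j hj
    exact h m rfl ⟨j, by omega⟩
  · intro h m' e j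
    obtain rfl : m = m' := by omega
    exact h j (by omega)

theorem act_degen {A : CoSA.{u, v} k} (hA : A.IsCosimplicial) {p n a : ℕ} {χ : ℕ → ℕ}
    (hV : V p n χ) (ha : a < p) (h : χ a = χ (a + 1)) {f : A.X p} (hf : f ∈ A.N p) :
    act p n A χ f = 0 := by
  obtain ⟨p, rfl⟩ : ∃ p', p = p' + 1 := ⟨p - 1, by omega⟩
  have hf' := mem_N_succ.1 hf a (by omega)
  rw [act_ssg hA (by omega)] at hf'
  have hV' : V p n (χ ∘ dd a) := hV.comp (V_dd (by omega))
  have := act_comp hA (V_ss (n := p) (i := a) (by omega)) hV' f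
  rw [hf', map_zero] at this
  rw [this]
  apply act_ext hV
  intro b hb
  simp only [Function.comp, dd, ss]
  rcases lt_trichotomy b a with h1 | h1 | h1
  · grind
  · grind
  · rcases Nat.lt_or_ge (a + 1) b with h2 | h2
    · congr 1; grind
    · grind

theorem delta_apply {A : CoSA.{u, v} k} (n : ℕ) (x : A.X n) :
    A.delta n x = ∑ i ∈ Finset.range (n + 2), ((-1 : ℤ) ^ i) • A.d n i x := by
  simp [delta, LinearMap.sum_apply]

theorem act_degen_s {A : CoSA.{u, v} k} (hA : A.IsCosimplicial) {p n a b : ℕ} {χ : ℕ → ℕ}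
    (hV : V p (n + 1) χ) (hb : b ≤ n) (ha : a < p) (h : χ a = b) (h' : χ (a + 1) = b + 1)
    {f : A.X p} (hf : f ∈ A.N p) :
    A.s n b (act p (n + 1) A χ f) = 0 := by
  rw [s_act hA hV hb]
  exact act_degen hA ((V_ss hb).comp hV) ha (by simp [ss, h, h']) hf

theorem delta_mem_N {A : CoSA.{u, v} k} (hA : A.IsCosimplicial) {p : ℕ} {f : A.X p}
    (hf : f ∈ A.N p) : A.delta p f ∈ A.N (p + 1) := by
  rw [mem_N_succ]
  intro b hb
  rw [delta_apply, map_sum, Finset.sum_eq_add_of_mem b (b + 1) (by simp; omega) (by simp; omega)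
    (by omega)]
  · have h1 := DFunLike.congr_fun (hA.2.2.2.1 p b hb) f
    have h2 := DFunLike.congr_fun (hA.2.2.2.2.1 p b hb) f
    simp only [AlgHom.comp_apply, AlgHom.id_apply] at h1 h2
    rw [map_zsmul, map_zsmul, h1, h2, pow_succ]
    simp
  · rintro j hj ⟨h1, h2⟩
    have hj' : j < p + 2 := by simpa using hj
    rw [map_zsmul, act_dd hA (by omega)]
    rcases Nat.lt_or_ge j b with h | h
    · rw [act_degen_s hA (a := b - 1) (V_dd (by omega)) hb (by omega) _ _ hf, smul_zero] <;>
        simp only [dd] <;> grind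
    · rw [act_degen_s hA (a := b) (V_dd (by omega)) hb (by omega) _ _ hf, smul_zero] <;>
        simp only [dd] <;> grind

theorem N_s {A : CoSA.{u, v} k} {m : ℕ} {x : A.X (m + 1)} (h : x ∈ A.N (m + 1)) {j : ℕ}
    (hj : j ≤ m) : A.s m j x = 0 := mem_N_succ.1 h j hj

theorem mem_J {A : CoSA.{u, v} k} {m l : ℕ} (hl : l ≤ m) {z : A.X (m + 1)}
    (h1 : z ∈ A.Isub m ⟨l, by omega⟩ * A.Isub m ⟨l, by omega⟩) (h2 : z ∈ A.N (m + 1)) :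
    z ∈ A.Jsub (m + 1) := by
  rw [Jsub]
  refine Submodule.mem_iSup_of_mem m (Submodule.mem_iSup_of_mem rfl
    (Submodule.mem_iSup_of_mem ⟨l, by omega⟩ ?_))
  exact ⟨z, ⟨h1, h2⟩, rfl⟩

/-- the partial normalization -/
noncomputable def pr (A : CoSA.{u, v} k) (m : ℕ) : ℕ → (A.X (m + 1) →ₗ[k] A.X (m + 1))
  | 0 => LinearMap.id
  | c + 1 => (pr A m c).comp (LinearMap.id - ((A.d m c).comp (A.s m c)).toLinearMap)

theorem pr_succ {A : CoSA.{u, v} k} {m c : ℕ} (x : A.X (m + 1)) :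
    pr A m (c + 1) x = pr A m c (x - A.d m c (A.s m c x)) := rfl

theorem pr_N {A : CoSA.{u, v} k} {m : ℕ} {x : A.X (m + 1)} (h : x ∈ A.N (m + 1)) (c : ℕ)
    (hc : c ≤ m + 1) : pr A m c x = x := by
  induction c with
  | zero => rfl
  | succ c ih => rw [pr_succ, N_s h (by omega), map_zero, sub_zero, ih (by omega)]

theorem sds {A : CoSA.{u, v} k} (hA : A.IsCosimplicial) {m c l : ℕ} (h : c < l) (hl : l ≤ m)
    (x : A.X (m + 1)) (hx : A.s m l x = 0) : A.s m l (A.d m c (A.s m c x)) = 0 := by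
  obtain ⟨m, rfl⟩ : ∃ m', m = m' + 1 := ⟨m - 1, by omega⟩
  obtain ⟨l, rfl⟩ : ∃ l', l = l' + 1 := ⟨l - 1, by omega⟩
  have h1 := DFunLike.congr_fun (hA.2.2.1 m c (l + 1) h hl) (A.s (m + 1) c x)
  have h2 := DFunLike.congr_fun (hA.2.1 m c l (by omega) (by omega)) x
  simp only [AlgHom.comp_apply, Nat.add_sub_cancel] at h1 h2
  rw [h1, h2, hx, map_zero, map_zero]

theorem pr_mem {A : CoSA.{u, v} k} (hA : A.IsCosimplicial) {m l : ℕ} (hl : l ≤ m) :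
    ∀ (c : ℕ) (_ : c ≤ l) (z : A.X (m + 1))
    (_ : z ∈ A.Isub m ⟨l, by omega⟩ * A.Isub m ⟨l, by omega⟩)
    (_ : ∀ b, c ≤ b → b ≤ m → A.s m b z = 0), pr A m c z ∈ A.Jsub (m + 1) := by
  intro c
  induction c with
  | zero =>
    intro _ z h1 h2
    exact mem_J hl h1 (mem_N_succ.2 fun j hj => h2 j (by omega) hj)
  | succ c ih =>
    intro hc z h1 h2
    rw [pr_succ]
    apply ih (by omega)
    · apply sub_mem h1
      refine Submodule.mul_induction_on (C := fun z => A.d m c (A.s m c z) ∈ _) h1 ?_ ?_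
      · intro x hx y hy
        rw [map_mul, map_mul]
        exact Submodule.mul_mem_mul (sds hA (by omega) hl x hx) (sds hA (by omega) hl y hy)
      · intro x y hx hy
        rw [map_add, map_add]
        exact add_mem hx hy
    · intro b hb hb'
      rw [map_sub]
      rcases Nat.lt_or_ge c b with h | h
      · rw [h2 b (by omega) hb', sds hA h hb' z (h2 b (by omega) hb'), sub_zero]
      · obtain rfl : b = c := by omega
        have h1 := DFunLike.congr_fun (hA.2.2.2.1 m b hb') (A.s m b z)
        simp only [AlgHom.comp_apply, AlgHom.id_apply] at h1
        rw [h1, sub_self]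

/-- `x₀..xᵢ, x_{i+1+r}, ...` -/
def gap (i r a : ℕ) : ℕ := if a ≤ i then a else a + r
def sh (i b : ℕ) : ℕ := i + b
def rr (i r l a : ℕ) : ℕ := if a < i then a else if a = i then l else a + r

theorem V_gap {i r p n : ℕ} (h : p + r ≤ n) : V p n (gap i r) :=
  ⟨fun a b h _ => by simp only [gap]; grind, by simp only [gap]; grind⟩
theorem V_sh {i p n : ℕ} (h : i + p ≤ n) : V p n (sh i) :=
  ⟨fun a b h _ => by simp only [sh]; grind, h⟩
theorem V_rr {i r l p n : ℕ} (h : p + r ≤ n) (hl : i ≤ l) (hl' : l ≤ i + r + 1) (hi : i < p) :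
    V p n (rr i r l) :=
  ⟨fun a b h _ => by simp only [rr]; grind, by simp only [rr]; grind⟩

theorem key {A : CoSA.{u, v} k} (hA : A.IsCosimplicial) {P Q m i : ℕ} (hm : m + 1 = P + Q)
    (hi : i < P) (hQ : 1 ≤ Q) {F : A.X P} {G : A.X Q} (hF : F ∈ A.N P) (hG : G ∈ A.N Q) :
    act P m A (gap i (Q - 1)) F * act Q m A (sh i) G ∈ A.Jsub m := by
  obtain ⟨r, rfl⟩ : ∃ r, Q = r + 1 := ⟨Q - 1, by omega⟩
  obtain ⟨m, rfl⟩ : ∃ m', m = m' + 1 := ⟨m - 1, by omega⟩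
  rw [Nat.add_sub_cancel]
  set γ := act (r + 1) (m + 1) A (sh i) G with hγ
  have hγs : ∀ b, i ≤ b → b ≤ i + r → A.s m b γ = 0 := by
    intro b hb hb'
    exact act_degen_s hA (a := b - i) (V_sh (by omega)) (by omega) (by omega)
      (by simp only [sh]; omega) (by simp only [sh]; omega) hG
  set R : ℕ → A.X (m + 1) := fun l => act P (m + 1) A (rr i r l) F with hR
  have hRs : ∀ l, i ≤ l → l ≤ i + r + 1 → ∀ b, i + r < b → b ≤ m → A.s m b (R l) = 0 := by
    intro l hl hl' b hb hb'
    exact act_degen_s hA (a := b - r) (V_rr (by omega) hl hl' hi) (by omega) (by omega)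
      (by simp only [rr]; grind) (by simp only [rr]; grind) hF
  have hR0 : R (i + r + 1) = 0 :=
    act_degen hA (a := i) (V_rr (by omega) (by omega) (by omega) hi) hi
      (by simp only [rr]; grind) hF
  have hRi : act P (m + 1) A (gap i r) F = R i :=
    act_ext (V_gap (by omega)) (fun a ha => by simp only [gap, rr]; grind) F
  rw [hRi]
  have hN : R i * γ ∈ A.N (m + 1) := by
    rw [mem_N_succ]
    intro b hb
    rw [map_mul]
    rcases Nat.lt_or_ge b i with h | h
    · rw [← hRi, act_degen_s hA (a := b) (V_gap (by omega)) hb (by omega)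
        (by simp only [gap]; grind) (by simp only [gap]; grind) hF, zero_mul]
    · rcases Nat.lt_or_ge (i + r) b with h' | h'
      · rw [hRs i le_rfl (by omega) b h' hb, zero_mul]
      · rw [hγs b h h', mul_zero]
  have hsum : R i * γ = ∑ t ∈ Finset.range (r + 1), (R (i + t) - R (i + (t + 1))) * γ := by
    rw [← Finset.sum_mul, Finset.sum_range_sub' (fun t => R (i + t)), ← add_assoc i r 1, hR0,
      sub_zero, add_zero]
  rw [← pr_N hN i (by omega), hsum, map_sum]
  apply Submodule.sum_mem
  intro t ht
  have ht' : t < r + 1 := by simpa using ht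
  apply pr_mem hA (l := i + t) (by omega) i (by omega)
  · apply Submodule.mul_mem_mul
    · change A.s m (i + t) (R (i + t) - R (i + (t + 1))) = 0
      rw [map_sub, sub_eq_zero, hR]
      simp only
      rw [s_act hA (V_rr (by omega) (by omega) (by omega) hi) (by omega),
        s_act hA (V_rr (by omega) (by omega) (by omega) hi) (by omega)]
      refine act_ext ((V_ss (by omega)).comp (V_rr (by omega) (by omega) (by omega) hi)) ?_ F
      intro a ha
      simp only [Function.comp, rr, ss]
      grind
    · exact hγs (i + t) (by omega) (by omega)
  · intro b hb hb'
    rw [map_mul]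
    rcases Nat.lt_or_ge (i + r) b with h' | h'
    · rw [map_sub, hRs _ (by omega) (by omega) b h' hb', hRs _ (by omega) (by omega) b h' hb',
        sub_zero, zero_mul]
    · rw [hγs b hb h', mul_zero]

theorem J_le {A : CoSA.{u, v} k} {n : ℕ} {x : A.X n} (h : x ∈ A.Jsub n) : x ∈ A.Jhat n :=
  Submodule.mem_sup_left h

theorem dJ_le {A : CoSA.{u, v} k} {n : ℕ} {x : A.X n} (h : x ∈ A.Jsub n) :
    A.delta n x ∈ A.Jhat (n + 1) := by
  refine Submodule.mem_sup_right (Submodule.mem_iSup_of_mem n (Submodule.mem_iSup_of_mem rfl ?_))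
  exact ⟨x, h, rfl⟩

noncomputable def fc (A : CoSA.{u, v} k) (p q D : ℕ) (f : A.X p) (g : A.X q) (i j : ℕ) : A.X D :=
  act p D A (gap i (q - 1) ∘ dd j) f * act q D A (sh i) g

noncomputable def W (A : CoSA.{u, v} k) (p q D : ℕ) (f : A.X p) (g : A.X q) (i : ℕ) : A.X D :=
  ∑ j ∈ Finset.range (i + 1), ((-1 : ℤ) ^ j) • fc A p q D f g i j

theorem U_eq {A : CoSA.{u, v} k} (hA : A.IsCosimplicial) {p q D : ℕ} (hD : D = p + q)
    (hq : 1 ≤ q) (f : A.X p) (g : A.X q) (i : ℕ) :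
    act (p + 1) D A (gap i (q - 1)) (A.delta p f) * act q D A (sh i) g =
      ∑ j ∈ Finset.range (p + 2), ((-1 : ℤ) ^ j) • fc A p q D f g i j := by
  rw [delta_apply, map_sum, Finset.sum_mul]
  apply Finset.sum_congr rfl
  intro j hj
  have : j < p + 2 := by simpa using hj
  rw [map_zsmul, smul_mul_assoc, act_pre_d hA (V_gap (by omega)) (by omega), fc]

theorem U_split {A : CoSA.{u, v} k} {p q D : ℕ} (f : A.X p) (g : A.X q) {i : ℕ} (hi : i ≤ p) :
      ∑ j ∈ Finset.range (p + 2), ((-1 : ℤ) ^ j) • fc A p q D f g i j =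
      W A p q D f g i + ((-1 : ℤ) ^ (i + 1)) • fc A p q D f g i (i + 1)
      + ∑ t ∈ Finset.range (p - i), ((-1 : ℤ) ^ (i + t)) • fc A p q D f g i (i + 2 + t) := by
  rw [show p + 2 = (i + 1 + 1) + (p - i) by omega, Finset.sum_range_add, Finset.sum_range_succ, W]
  congr 1
  apply Finset.sum_congr rfl
  intro t _
  congr 1
  rw [show i + 1 + 1 + t = i + t + 2 by omega, pow_add]
  simp

theorem step {A : CoSA.{u, v} k} (hA : A.IsCosimplicial) {p q D i : ℕ} (hD : D = p + q)
    (hq : 1 ≤ q) (hi : i < p) {f : A.X p} {g : A.X q} (hf : f ∈ A.N p) (hg : g ∈ A.N q) :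
    W A p q D f g (i + 1) + ((-1 : ℤ) ^ q) • W A p q D f g i ∈ A.Jhat D := by
  obtain ⟨r, rfl⟩ : ∃ r, q = r + 1 := ⟨q - 1, by omega⟩
  obtain ⟨m, rfl⟩ : ∃ m', D = m' + 1 := ⟨D - 1, by omega⟩
  have hU := J_le (key hA (m := m + 1) (i := i) (by omega) (by omega) hq (delta_mem_N hA hf) hg)
  have hV := J_le (key hA (m := m + 1) (i := i) (by omega) hi (by omega) hf (delta_mem_N hA hg))
  have hT := dJ_le (key hA (m := m) (i := i) (by omega) hi hq hf hg)
  rw [U_eq hA hD hq, U_split f g hi.le] at hU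
  -- expand V
  have eV : act p (m + 1) A (gap i (r + 1 + 1 - 1)) f *
      act (r + 1 + 1) (m + 1) A (sh i) (A.delta (r + 1) g) =
      fc A p (r + 1) (m + 1) f g (i + 1) (i + 1) +
      ∑ t ∈ Finset.range (r + 1), ((-1 : ℤ) ^ (t + 1)) •
        (act p (m + 1) A (gap i (r + 1)) f * act (r + 1) (m + 1) A (sh i ∘ dd (t + 1)) g)
      + ((-1 : ℤ) ^ (r + 2)) • fc A p (r + 1) (m + 1) f g i (i + 1) := by
    rw [delta_apply, map_sum, Finset.mul_sum, Finset.sum_range_succ, Finset.sum_range_succ',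
      add_comm (∑ t ∈ Finset.range (r + 1), _)]
    congr 1
    · congr 1
      · rw [pow_zero, one_smul, act_pre_d hA (V_sh (by omega)) (by omega), fc]
        congr 1
        · refine act_ext (V_gap (by omega)) (fun a ha => ?_) f
          simp only [Function.comp, gap, dd]; grind
        · refine act_ext ((V_sh (n := m + 1) (by omega)).comp (V_dd (by omega))) (fun a ha => ?_) g
          simp only [Function.comp, sh, dd]; grind
      · apply Finset.sum_congr rfl
        intro t ht
        have : t < r + 1 := by simpa using ht
        rw [map_zsmul, mul_smul_comm, act_pre_d hA (V_sh (by omega)) (by omega)]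
        rfl
    · rw [map_zsmul, mul_smul_comm, act_pre_d hA (V_sh (by omega)) (by omega), fc]
      congr 2
      · refine act_ext (V_gap (by omega)) (fun a ha => ?_) f
        simp only [Function.comp, gap, dd]; grind
      · refine act_ext ((V_sh (n := m + 1) (by omega)).comp (V_dd (by omega))) (fun a ha => ?_) g
        simp only [Function.comp, sh, dd]; grind
  have eT : A.delta m (act p m A (gap i (r + 1 - 1)) f * act (r + 1) m A (sh i) g) =
      ∑ j ∈ Finset.range (i + 1), ((-1 : ℤ) ^ j) • fc A p (r + 1) (m + 1) f g (i + 1) j +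
      ((-1 : ℤ) ^ i) • ∑ t ∈ Finset.range (r + 1), ((-1 : ℤ) ^ (t + 1)) •
        (act p (m + 1) A (gap i (r + 1)) f * act (r + 1) (m + 1) A (sh i ∘ dd (t + 1)) g) +
      ((-1 : ℤ) ^ r) • ∑ t ∈ Finset.range (p - i),
        ((-1 : ℤ) ^ (i + t)) • fc A p (r + 1) (m + 1) f g i (i + 2 + t) := by
    rw [delta_apply, show m + 2 = (i + 1) + (r + 1) + (p - i) by omega, Finset.sum_range_add,
      Finset.sum_range_add, Finset.smul_sum, Finset.smul_sum]
    congr 1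
    · congr 1
      · apply Finset.sum_congr rfl
        intro j hj
        have : j < i + 1 := by simpa using hj
        rw [map_mul, d_act hA (V_gap (by omega)) (by omega), d_act hA (V_sh (by omega)) (by omega),
          fc]
        congr 2
        · refine act_ext ((V_dd (by omega)).comp (V_gap (by omega))) (fun a ha => ?_) f
          simp only [Function.comp, gap, dd]; grind
        · refine act_ext ((V_dd (by omega)).comp (V_sh (by omega))) (fun a ha => ?_) g
          simp only [Function.comp, sh, dd]; grind
      · apply Finset.sum_congr rfl
        intro t ht
        have : t < r + 1 := by simpa using ht
        rw [map_mul, d_act hA (V_gap (by omega)) (by omega), d_act hA (V_sh (by omega)) (by omega),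
          smul_smul, ← pow_add]
        congr 2
        · omega
        · refine act_ext ((V_dd (by omega)).comp (V_gap (by omega))) (fun a ha => ?_) f
          simp only [Function.comp, gap, dd]; grind
        · refine act_ext ((V_dd (by omega)).comp (V_sh (by omega))) (fun a ha => ?_) g
          simp only [Function.comp, sh, dd]; grind
    · apply Finset.sum_congr rfl
      intro t ht
      have : t < p - i := by simpa using ht
      rw [map_mul, d_act hA (V_gap (by omega)) (by omega), d_act hA (V_sh (by omega)) (by omega),
          smul_smul, ← pow_add, fc, show i + 1 + (r + 1) + t = r + (i + t) + 2 by omega,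
          pow_add _ _ 2, neg_one_sq, mul_one]
      congr 2
      · refine act_ext ((V_dd (by omega)).comp (V_gap (by omega))) (fun a ha => ?_) f
        simp only [Function.comp, gap, dd]; grind
      · refine act_ext ((V_dd (by omega)).comp (V_sh (by omega))) (fun a ha => ?_) g
        simp only [Function.comp, sh, dd]; grind
  rw [eV] at hV
  rw [eT] at hT
  rw [W, Finset.sum_range_succ]
  generalize (∑ j ∈ Finset.range (i + 1),
    ((-1 : ℤ) ^ j) • fc A p (r + 1) (m + 1) f g (i + 1) j) = Lo at *
  generalize (∑ t ∈ Finset.range (r + 1), ((-1 : ℤ) ^ (t + 1)) •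
        (act p (m + 1) A (gap i (r + 1)) f * act (r + 1) (m + 1) A (sh i ∘ dd (t + 1)) g)) = M at *
  generalize (∑ t ∈ Finset.range (p - i),
        ((-1 : ℤ) ^ (i + t)) • fc A p (r + 1) (m + 1) f g i (i + 2 + t)) = H at *
  generalize fc A p (r + 1) (m + 1) f g (i + 1) (i + 1) = B at *
  generalize fc A p (r + 1) (m + 1) f g i (i + 1) = C at *
  generalize W A p (r + 1) (m + 1) f g i = w at *
  have := sub_mem hT (add_mem (zsmul_mem hV ((-1 : ℤ) ^ i)) (zsmul_mem hU ((-1 : ℤ) ^ r)))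
  convert this using 1
  rw [pow_succ _ r, pow_succ _ i, pow_add _ r 2]
  rcases neg_one_pow_eq_or ℤ i with h | h <;> rcases neg_one_pow_eq_or ℤ r with h' | h' <;>
    rw [h, h'] <;> module

theorem main {A : CoSA.{u, v} k} (hA : A.IsCosimplicial) {p q D : ℕ} (hD : D = p + q)
    (hq : 1 ≤ q) {f : A.X p} {g : A.X q} (hf : f ∈ A.N p) (hg : g ∈ A.N q) :
    act p D A (sh 0) f * act q D A (sh p) g -
      ((-1 : ℤ) ^ (p * q)) • (act p D A (sh q) f * act q D A (sh 0) g) ∈ A.Jhat D := by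
  have hW : ∀ i, i ≤ p →
      W A p q D f g i - ((-1 : ℤ) ^ ((q + 1) * i)) • W A p q D f g 0 ∈ A.Jhat D := by
    intro i
    induction i with
    | zero => intro _; simp
    | succ i ih =>
      intro hi
      have := sub_mem (step hA hD hq (i := i) (by omega) hf hg)
        (zsmul_mem (ih (by omega)) ((-1 : ℤ) ^ q))
      convert this using 1
      rw [Nat.mul_succ, pow_add _ _ (q + 1), pow_succ _ q]
      rcases neg_one_pow_eq_or ℤ ((q + 1) * i) with h | h <;>
      rcases neg_one_pow_eq_or ℤ q with h' | h' <;>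
      rw [h, h'] <;> module
  have hU := J_le (key hA (m := D) (i := p) (by omega) (by omega) hq (delta_mem_N hA hf) hg)
  rw [U_eq hA hD hq, U_split f g le_rfl] at hU
  rw [Nat.sub_self, Finset.sum_range_zero, add_zero] at hU
  have e0 : W A p q D f g 0 = act p D A (sh q) f * act q D A (sh 0) g := by
    rw [W, Finset.sum_range_one, pow_zero, one_smul, fc]
    congr 1
    refine act_ext ((V_gap (p := p + 1) (by omega)).comp (V_dd (by omega))) (fun a ha => ?_) f
    simp only [Function.comp, gap, dd, sh]; grind
  have ep : fc A p q D f g p (p + 1) = act p D A (sh 0) f * act q D A (sh p) g := by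
    rw [fc]
    congr 1
    refine act_ext ((V_gap (p := p + 1) (by omega)).comp (V_dd (by omega))) (fun a ha => ?_) f
    simp only [Function.comp, gap, dd, sh]; grind
  rw [ep] at hU
  have h1 := hW p le_rfl
  rw [e0] at h1
  have := zsmul_mem (sub_mem h1 hU) ((-1 : ℤ) ^ p)
  convert this using 1
  rw [show (q + 1) * p = p * q + p by ring, pow_add _ _ p, pow_succ _ p]
  rcases neg_one_pow_eq_or ℤ (p * q) with h | h <;>
  rcases neg_one_pow_eq_or ℤ p with h' | h' <;>
  rw [h, h'] <;> module

theorem dIter_last {A : CoSA.{u, v} k} (hA : A.IsCosimplicial) (p m : ℕ) (f : A.X p) :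
    A.dIter (p + 1) p m f = act p (p + m) A (sh 0) f := by
  induction m with
  | zero =>
    conv_lhs => rw [← act_id_apply (A.dIter (p + 1) p 0 f)]
    exact act_ext (V_id le_rfl) (fun a _ => by simp [sh]) f
  | succ m ih =>
    change A.d (p + m) (p + 1) (A.dIter (p + 1) p m f) = _
    rw [ih, d_act hA (V_sh (by omega)) (by omega)]
    refine act_ext ((V_dd (by omega)).comp (V_sh (by omega))) (fun a ha => ?_) f
    simp only [Function.comp, dd, sh]; grind

theorem dIter_zero {A : CoSA.{u, v} k} (hA : A.IsCosimplicial) (p m : ℕ) (f : A.X p) :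
    A.dIter 0 p m f = act p (p + m) A (sh m) f := by
  induction m with
  | zero =>
    conv_lhs => rw [← act_id_apply (A.dIter 0 p 0 f)]
    exact act_ext (V_id le_rfl) (fun a _ => by simp [sh]) f
  | succ m ih =>
    change A.d (p + m) 0 (A.dIter 0 p m f) = _
    rw [ih, d_act hA (V_sh (by omega)) (by omega)]
    refine act_ext ((V_dd (by omega)).comp (V_sh (by omega))) (fun a ha => ?_) f
    simp only [Function.comp, dd, sh]; grind

theorem xc_act {A : CoSA.{u, v} k} {p a b : ℕ} (h : a = b) (φ : ℕ → ℕ) (x : A.X p) :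
    A.xc h (act p a A φ x) = act p b A φ x := by
  subst h; rfl

theorem xc_mul {A : CoSA.{u, v} k} {a b : ℕ} (h : a = b) (x y : A.X a) :
    A.xc h (x * y) = A.xc h x * A.xc h y := by
  subst h; rfl

theorem cup_eq {A : CoSA.{u, v} k} (hA : A.IsCosimplicial) (p q : ℕ) (f : A.X p) (g : A.X q) :
    A.cup p q f g = act p (p + q) A (sh 0) f * act q (p + q) A (sh p) g := by
  change A.dIter (p + 1) p q f * A.xc (Nat.add_comm q p) (A.dIter 0 q p g) = _
  rw [dIter_last hA, dIter_zero hA, xc_act]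

end CoSA

/-- If each `X^n` is commutative then the cup product is graded commutative
modulo the differentiating ideal: `f ∪ g - (-1)^{pq} g ∪ f ∈ Ĵ_X` for normalized `f, g`. -/
theorem stmt_3 {k : Type u} [Field k] (A : CoSA k) (hA : A.IsCosimplicial)
    (hcomm : ∀ n (a b : A.X n), a * b = b * a) :
    ∀ (p q : ℕ) (f : A.X p) (g : A.X q), f ∈ A.N p → g ∈ A.N q →
      A.cup p q f g - ((-1 : ℤ) ^ (p * q)) • A.xc (Nat.add_comm q p) (A.cup q p g f)
        ∈ A.Jhat (p + q) := by
  intro p q f g hf hg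
  rw [CoSA.cup_eq hA, CoSA.cup_eq hA, CoSA.xc_mul, CoSA.xc_act, CoSA.xc_act,
    hcomm (p + q) (CoSA.act q _ A (CoSA.sh 0) g)]
  rcases Nat.eq_zero_or_pos q with h | h
  · rcases Nat.eq_zero_or_pos p with h' | h'
    · subst h h'
      simp
    · have := zsmul_mem (CoSA.main hA (D := p + q) (Nat.add_comm p q) h' hg hf)
        (-(-1 : ℤ) ^ (p * q))
      convert this using 1
      rw [hcomm _ (CoSA.act q _ A (CoSA.sh 0) g), hcomm _ (CoSA.act q _ A (CoSA.sh p) g),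
        Nat.mul_comm q p]
      rcases neg_one_pow_eq_or ℤ (p * q) with h1 | h1 <;> rw [h1] <;> module
  · exact CoSA.main hA rfl h hf hg
end

section
/- Let X be a reduced small cosimplicial k-algebra. Then for every n ≥ 1 and every 1 ≤ j ≤ n the product of any two elements of I_{n,j} = ker(s^{j-1} : X^n → X^{n-1}) is zero, i.e. I_{n,j} · I_{n,j} = 0; in particular the differentiating ideal Ĵ_X is zero (X is infinitesimal). -/
/-! Statement 4: in a reduced small cosimplicial algebra the product of any two elements of
`I_{n,j} = ker (s^{j-1})` vanishes; in particular the differentiating ideal is zero. -/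

universe u v

variable {k : Type u} [Field k]

/-- Iterated cup product `f 1 ∪ f 2 ∪ ⋯ ∪ f n` (left bracketed) of degree-one cochains. -/
noncomputable def CoSA.cupIter (A : CoSA k) : (n : ℕ) → (Fin (n + 1) → A.X 1) → A.X (n + 1)
  | 0, f => f 0
  | (n + 1), f => A.cup (n + 1) 1 (A.cupIter n (Fin.init f)) (f (Fin.last (n + 1)))

namespace StmtAux

/-- pullback along the last edge -/
noncomputable def E (A : CoSA k) : (n : ℕ) → (A.X 1 →ₐ[k] A.X (n + 1))
  | 0 => AlgHom.id k _
  | (n + 1) => (A.d (n + 1) 0).comp (E A n)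

lemma xc_d (A : CoSA k) {a b : ℕ} (h : a = b) (h' : a + 1 = b + 1) (i : ℕ) (x : A.X a) :
    A.xc h' (A.d a i x) = A.d b i (A.xc h x) := by
  subst h; rfl

lemma xc_E (A : CoSA k) (n : ℕ) (h : 1 + n = n + 1) (f : A.X 1) :
    A.xc h (A.dIter 0 1 n f) = E A n f := by
  induction n with
  | zero => rfl
  | succ n ih =>
    have := ih (by omega)
    change A.xc h (A.d (1 + n) 0 (A.dIter 0 1 n f)) = A.d (n + 1) 0 (E A n f)
    rw [← this]
    exact xc_d A _ _ _ _

lemma cup_eq (A : CoSA k) (n : ℕ) (u : A.X (n + 1)) (f : A.X 1) :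
    A.cup (n + 1) 1 u f = A.d (n + 1) (n + 2) u * E A (n + 1) f := by
  rw [← xc_E A (n + 1) (Nat.add_comm 1 (n + 1))]
  rfl

lemma s_E (A : CoSA k) (hA : A.IsCosimplicial) (n : ℕ) (f : A.X 1) :
    ∀ j, j ≤ n → A.s (n + 1) j (E A (n + 1) f) = E A n f := by
  obtain ⟨_, _, h3, h4, _, _⟩ := hA
  induction n with
  | zero =>
    intro j hj
    obtain rfl : j = 0 := by omega
    exact DFunLike.congr_fun (h4 1 0 (by omega)) _
  | succ n ih =>
    intro j hj
    cases j with
    | zero => exact DFunLike.congr_fun (h4 (n + 2) 0 (by omega)) _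
    | succ j =>
      have := DFunLike.congr_fun (h3 (n + 1) 0 (j + 1) (by omega) (by omega)) (E A (n + 1) f)
      refine this.trans ?_
      change A.d (n + 1) 0 (A.s (n + 1) j (E A (n + 1) f)) = _
      rw [ih j (by omega)]
      rfl

lemma s_E_last (A : CoSA k) (hA : A.IsCosimplicial) (n : ℕ) (f : A.X 1) (c : k)
    (hc : A.s 0 0 f = algebraMap k _ c) :
    A.s n n (E A n f) = algebraMap k _ c := by
  obtain ⟨_, _, h3, h4, _, _⟩ := hA
  induction n with
  | zero => exact hc
  | succ n ih =>
    have := DFunLike.congr_fun (h3 n 0 (n + 1) (by omega) (by omega)) (E A n f)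
    refine this.trans ?_
    change A.d n 0 (A.s n n (E A n f)) = _
    rw [ih, AlgHom.commutes]

lemma d_E (A : CoSA k) (hA : A.IsCosimplicial) (n : ℕ) (f : A.X 1) :
    ∀ j, j ≤ n → A.d (n + 1) j (E A n f) = E A (n + 1) f := by
  obtain ⟨h1, _⟩ := hA
  induction n with
  | zero =>
    intro j hj
    obtain rfl : j = 0 := by omega
    rfl
  | succ n ih =>
    intro j hj
    cases j with
    | zero => rfl
    | succ j =>
      have := DFunLike.congr_fun (h1 (n + 1) 0 (j + 1) (by omega) (by omega)) (E A n f)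
      refine this.trans ?_
      change A.d (n + 2) 0 (A.d (n + 1) j (E A n f)) = _
      rw [ih j (by omega)]
      rfl

open scoped Pointwise in
lemma span_mul_zero {R : Type*} [Ring R] [Algebra k R] (hcomm : ∀ a b : R, a * b = b * a)
    (T : Set R) (hT : ∀ a ∈ T, ∀ b ∈ T, a * b = 0) (x y : R)
    (hx : x ∈ Submodule.span k {z | ∃ w ∈ T, ∃ c, z = w * c})
    (hy : y ∈ Submodule.span k {z | ∃ w ∈ T, ∃ c, z = w * c}) : x * y = 0 := by
  have h := Submodule.mul_mem_mul hx hy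
  rw [Submodule.span_mul_span] at h
  have h0 : ({z | ∃ w ∈ T, ∃ c, z = w * c} * {z | ∃ w ∈ T, ∃ c, z = w * c} : Set R) ⊆ {0} := by
    rintro _ ⟨_, ⟨w, hw, c, rfl⟩, _, ⟨w', hw', c', rfl⟩, rfl⟩
    change w * c * (w' * c') = 0
    rw [hcomm w c, mul_assoc, ← mul_assoc w, hT w hw w' hw', zero_mul, mul_zero]
  have := Submodule.span_mono (R := k) h0 h
  simpa using this

lemma span_cup (A : CoSA k) (n : ℕ)
    (hs : (⊤ : Submodule k (A.X (n + 2))) ≤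
      Submodule.span k {x : A.X (n + 2) | ∃ f : Fin (n + 2) → A.X 1, x = A.cupIter (n + 1) f})
    (F : A.X (n + 2) →ₗ[k] A.X (n + 2)) (T : Set (A.X (n + 2)))
    (h : ∀ (u : A.X (n + 1)) (f : A.X 1), ∃ w ∈ T, ∃ c,
      A.d (n + 1) (n + 2) u * E A (n + 1) f - F (A.d (n + 1) (n + 2) u * E A (n + 1) f) = w * c)
    (x : A.X (n + 2)) (hx : F x = 0) :
    x ∈ Submodule.span k {z | ∃ w ∈ T, ∃ c, z = w * c} := by
  have key : ∀ x, x - F x ∈ Submodule.span k {z | ∃ w ∈ T, ∃ c, z = w * c} := by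
    intro x
    have hx := hs (Submodule.mem_top (x := x))
    have : Submodule.span k {x : A.X (n + 2) | ∃ f : Fin (n + 2) → A.X 1,
        x = A.cupIter (n + 1) f} ≤
        (Submodule.span k {z | ∃ w ∈ T, ∃ c, z = w * c}).comap (LinearMap.id - F) := by
      rw [Submodule.span_le]
      rintro _ ⟨f, rfl⟩
      apply Submodule.subset_span
      have := h (A.cupIter n (Fin.init f)) (f (Fin.last (n + 1)))
      rw [← cup_eq] at this
      exact this
    exact this hx
  simpa [hx] using key x

lemma main (A : CoSA k) (hA : A.IsCosimplicial)
    (hred : Function.Bijective (algebraMap k (A.X 0)))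
    (hcomm : ∀ n (a b : A.X n), a * b = b * a)
    (hsmall : ∀ n, (⊤ : Submodule k (A.X (n + 1))) ≤
      Submodule.span k {x : A.X (n + 1) | ∃ f : Fin (n + 1) → A.X 1, x = A.cupIter n f})
    (hI11 : ∀ a b : A.X 1, A.s 0 0 a = 0 → A.s 0 0 b = 0 → a * b = 0) (n : ℕ) :
    ∀ (j : ℕ), j ≤ n → ∀ (a b : A.X (n + 1)),
        A.s n j a = 0 → A.s n j b = 0 → a * b = 0 := by
  have hA' := hA
  obtain ⟨h1, h2, h3, h4, h5, h6⟩ := hA'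
  induction n with
  | zero =>
    intro j hj
    obtain rfl : j = 0 := by omega
    exact hI11
  | succ n ih =>
    intro j hj a b ha hb
    rcases Nat.lt_or_ge n j with hjn | hjn
    · obtain rfl : j = n + 1 := by omega
      let T : Set (A.X (n + 2)) := {z | ∃ g, A.s 0 0 g = 0 ∧ z = E A (n + 1) g}
      have hT : ∀ a ∈ T, ∀ b ∈ T, a * b = 0 := by
        rintro _ ⟨g, hg, rfl⟩ _ ⟨g', hg', rfl⟩
        rw [← map_mul, hI11 g g' hg hg', map_zero]
      have key := span_cup A n (hsmall (n + 1))
        ((A.d (n + 1) (n + 2)).comp (A.s (n + 1) (n + 1))).toLinearMap T (by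
          intro u f
          obtain ⟨c, hc⟩ := hred.2 (A.s 0 0 f)
          refine ⟨E A (n + 1) (f - algebraMap k _ c), ⟨_, ?_, rfl⟩, A.d (n + 1) (n + 2) u, ?_⟩
          · rw [map_sub, AlgHom.commutes, hc, sub_self]
          · have e : A.s (n + 1) (n + 1) (A.d (n + 1) (n + 2) u) = u :=
              DFunLike.congr_fun (h5 (n + 1) (n + 1) le_rfl) u
            change _ - A.d (n + 1) (n + 2) (A.s (n + 1) (n + 1) _) = _
            rw [map_mul (A.s (n + 1) (n + 1)), e, s_E_last A hA (n + 1) f c hc.symm,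
              map_mul (A.d (n + 1) (n + 2)), AlgHom.commutes, ← mul_sub, hcomm, map_sub, AlgHom.commutes])
      refine span_mul_zero (hcomm _) T hT a b (key a ?_) (key b ?_)
      · change A.d (n + 1) (n + 2) (A.s (n + 1) (n + 1) a) = 0
        rw [ha, map_zero]
      · change A.d (n + 1) (n + 2) (A.s (n + 1) (n + 1) b) = 0
        rw [hb, map_zero]
    · let T : Set (A.X (n + 2)) := {z | ∃ w, A.s n j w = 0 ∧ z = A.d (n + 1) (n + 2) w}
      have hT : ∀ a ∈ T, ∀ b ∈ T, a * b = 0 := by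
        rintro _ ⟨g, hg, rfl⟩ _ ⟨g', hg', rfl⟩
        rw [← map_mul, ih j hjn g g' hg hg', map_zero]
      have key := span_cup A n (hsmall (n + 1))
        ((A.d (n + 1) j).comp (A.s (n + 1) j)).toLinearMap T (by
          intro u f
          refine ⟨A.d (n + 1) (n + 2) (u - A.d n j (A.s n j u)), ⟨_, ?_, rfl⟩,
            E A (n + 1) f, ?_⟩
          · have e : A.s n j (A.d n j (A.s n j u)) = A.s n j u :=
              DFunLike.congr_fun (h4 n j hjn) _
            rw [map_sub, e, sub_self]
          · have e : A.s (n + 1) j (A.d (n + 1) (n + 2) u) = A.d n (n + 1) (A.s n j u) :=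
              DFunLike.congr_fun (h6 n (n + 2) j (by omega) (by omega)) u
            have e' : A.d (n + 1) (n + 2) (A.d n j (A.s n j u))
                = A.d (n + 1) j (A.d n (n + 1) (A.s n j u)) :=
              DFunLike.congr_fun (h1 n j (n + 2) (by omega) (by omega)) _
            change _ - A.d (n + 1) j (A.s (n + 1) j _) = _
            rw [map_mul (A.s (n + 1) j), e, s_E A hA n f j hjn,
              map_mul (A.d (n + 1) j), d_E A hA n f j hjn, ← sub_mul, map_sub, e'])
      refine span_mul_zero (hcomm _) T hT a b (key a ?_) (key b ?_)
      · change A.d (n + 1) j (A.s (n + 1) j a) = 0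
        rw [ha, map_zero]
      · change A.d (n + 1) j (A.s (n + 1) j b) = 0
        rw [hb, map_zero]

end StmtAux

/-- Let `X` be a reduced small cosimplicial algebra: `k → X^0` is bijective,
each `X^n` is commutative and, for `n ≥ 1`, spanned by cup products of `n` elements of `X^1`,
and `I_{1,1}·I_{1,1} = 0`.  Then the product of any two elements of
`I_{n,j} = ker (s^{j-1} : X^n → X^{n-1})` is zero for all `n ≥ 1`, `1 ≤ j ≤ n`;
in particular the differentiating ideal `Ĵ_X` is zero (`X` is infinitesimal). -/
theorem stmt_4 {k : Type u} [Field k] (A : CoSA k) (hA : A.IsCosimplicial)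
    (hred : Function.Bijective (algebraMap k (A.X 0)))
    (hcomm : ∀ n (a b : A.X n), a * b = b * a)
    (hsmall : ∀ n, (⊤ : Submodule k (A.X (n + 1))) ≤
      Submodule.span k {x : A.X (n + 1) | ∃ f : Fin (n + 1) → A.X 1, x = A.cupIter n f})
    (hI11 : ∀ a b : A.X 1, A.s 0 0 a = 0 → A.s 0 0 b = 0 → a * b = 0) :
    (∀ (n : ℕ) (j : Fin (n + 1)) (a b : A.X (n + 1)),
        A.s n j a = 0 → A.s n j b = 0 → a * b = 0) ∧
    (∀ n, A.Jhat n = ⊥) := by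
  have h := StmtAux.main A hA hred hcomm hsmall hI11
  have h' : ∀ (n : ℕ) (j : Fin (n + 1)) (a b : A.X (n + 1)),
        A.s n j a = 0 → A.s n j b = 0 → a * b = 0 :=
    fun n j => h n j (by omega)
  have hJ : ∀ n, A.Jsub n = ⊥ := by
    intro n
    have hI : ∀ (m : ℕ) (j : Fin (m + 1)), A.Isub m j * A.Isub m j = ⊥ := by
      intro m j
      rw [eq_bot_iff, Submodule.mul_le]
      intro a ha b hb
      exact h' m j a b ha hb
    simp [CoSA.Jsub, hI]
  refine ⟨h', fun n => ?_⟩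
  simp [CoSA.Jhat, hJ]
end

section
/- Let m, k ∈ ℕ, T ⊆ {1,…,k}, and let f : ℝ^m × ℝ^k → ℝ be a C^∞ function such that f(x, v) = 0 whenever v_i = 0 for all i ∈ T. For v ∈ ℝ^k and t ∈ [0,1], let v^t ∈ ℝ^k be defined by (v^t)_i = t·v_i for i ∈ T and (v^t)_i = v_i for i ∉ T, and for i ∈ T define f_i(x, v) = ∫_0^1 (∂f/∂v_i)(x, v^t) dt. Then: (1) each f_i is C^∞ and f(x, v) = Σ_{i∈T} v_i · f_i(x, v) for all (x, v); (2) for any T' ⊆ {1,…,k} and any i ∈ T with i ∉ T', if f vanishes on ℝ^m × Z_{T'} then f_i also vanishes on ℝ^m × Z_{T'}; (3) if moreover ∂f/∂v_i vanishes on ℝ^m × Z_T for every i ∈ T, then every f_i vanishes on ℝ^m × Z_T. -/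
/-! Statement 13: the Hadamard-type expansion with order refinements. -/

open MeasureTheory

theorem aux_param {E : Type} [NormedAddCommGroup E] [NormedSpace ℝ E] [ProperSpace E] (n : ℕ) :
    ∀ {G : Type} [NormedAddCommGroup G] [NormedSpace ℝ G] (g : E × ℝ → G),
      ContDiff ℝ n g → ContDiff ℝ n (fun x => ∫ t in (0 : ℝ)..1, g (x, t)) := by
  induction n with
  | zero =>
    intro G _ _ g hg
    have hc : Continuous g := hg.continuous
    rw [Nat.cast_zero, contDiff_zero]
    exact intervalIntegral.continuous_parametric_intervalIntegral_of_continuous'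
      (f := fun x t => g (x, t)) hc 0 1
  | succ n ih =>
    intro G _ _ g hg
    have hg' : ContDiff ℝ ((n : WithTop ℕ∞) + 1) g := by exact_mod_cast hg
    have hd := contDiff_succ_iff_fderiv.1 hg'
    have hcg : Continuous g := hg.continuous
    let g' : E × ℝ → E →L[ℝ] G := fun p => (fderiv ℝ g p).comp (ContinuousLinearMap.inl ℝ E ℝ)
    have hg'c : ContDiff ℝ n g' := hd.2.2.clm_comp contDiff_const
    have hcg' : Continuous g' := hg'c.continuous
    have key : ContDiff ℝ ((n : WithTop ℕ∞) + 1) (fun x => ∫ t in (0 : ℝ)..1, g (x, t)) := by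
      refine contDiff_succ_iff_hasFDerivAt.2 ⟨_, ih g' hg'c, fun x₀ => ?_⟩
      obtain ⟨C, hC⟩ := ((isCompact_closedBall x₀ 1).prod
        (isCompact_Icc (a := (0 : ℝ)) (b := 1))).exists_bound_of_continuousOn hcg'.continuousOn
      refine intervalIntegral.hasFDerivAt_integral_of_dominated_of_fderiv_le
        (F := fun x t => g (x, t)) (F' := fun x t => g' (x, t)) (bound := fun _ => C)
        (Metric.closedBall_mem_nhds x₀ one_pos) ?_ ?_ ?_ ?_ ?_ ?_
      · exact Filter.Eventually.of_forall fun x =>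
          (hcg.comp (Continuous.prodMk_right x)).aestronglyMeasurable
      · exact (hcg.comp (Continuous.prodMk_right x₀)).intervalIntegrable _ _
      · exact (hcg'.comp (Continuous.prodMk_right x₀)).aestronglyMeasurable
      · refine Filter.Eventually.of_forall fun t ht x hx => hC (x, t) ⟨hx, ?_⟩
        rw [Set.uIoc_of_le zero_le_one] at ht
        exact ⟨ht.1.le, ht.2⟩
      · exact intervalIntegrable_const
      · refine Filter.Eventually.of_forall fun t ht x hx => ?_
        exact (hd.1 (x, t)).hasFDerivAt.comp x (hasFDerivAt_prodMk_left x t)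
    exact_mod_cast key

/-- Let `f : ℝ^m × ℝ^k → ℝ` be `C^∞` and vanish on `ℝ^m × Z_T`, where
`Z_T = {v : v_i = 0 ∀ i ∈ T}`.  With `v^t` scaling the `T`-coordinates by `t` and
`f_i(x,v) = ∫_0^1 (∂f/∂v_i)(x, v^t) dt` for `i ∈ T`:
(1) each `f_i` is `C^∞` and `f(x,v) = Σ_{i ∈ T} v_i f_i(x,v)`;
(2) if `f` vanishes on `ℝ^m × Z_{T'}` and `i ∈ T`, `i ∉ T'`, then `f_i` vanishes on
`ℝ^m × Z_{T'}`;
(3) if all the partials `∂f/∂v_i` (`i ∈ T`) vanish on `ℝ^m × Z_T`, then so do all the `f_i`. -/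
theorem stmt_13 (m k : ℕ) (T : Finset (Fin k))
    (f : (Fin m → ℝ) × (Fin k → ℝ) → ℝ)
    (hf : ContDiff ℝ (⊤ : ℕ∞) f)
    (hvan : ∀ (x : Fin m → ℝ) (v : Fin k → ℝ), (∀ i ∈ T, v i = 0) → f (x, v) = 0)
    (vt : (Fin k → ℝ) → ℝ → (Fin k → ℝ))
    (hvt : ∀ v t i, vt v t i = if i ∈ T then t * v i else v i)
    (F : Fin k → ((Fin m → ℝ) × (Fin k → ℝ)) → ℝ)
    (hF : ∀ (i : Fin k) (x : Fin m → ℝ) (v : Fin k → ℝ),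
      F i (x, v) = ∫ t in (0 : ℝ)..1, fderiv ℝ f (x, vt v t) (0, Pi.single i 1)) :
    ((∀ i ∈ T, ContDiff ℝ (⊤ : ℕ∞) (F i)) ∧
      (∀ x v, f (x, v) = ∑ i ∈ T, v i * F i (x, v))) ∧
    (∀ T' : Finset (Fin k), ∀ i ∈ T, i ∉ T' →
      (∀ x v, (∀ l ∈ T', v l = 0) → f (x, v) = 0) →
      (∀ x v, (∀ l ∈ T', v l = 0) → F i (x, v) = 0)) ∧
    ((∀ i ∈ T, ∀ x v, (∀ l ∈ T, v l = 0) → fderiv ℝ f (x, v) (0, Pi.single i 1) = 0) →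
      ∀ i ∈ T, ∀ x v, (∀ l ∈ T, v l = 0) → F i (x, v) = 0) := by
  have hvtc : ContDiff ℝ (⊤ : ℕ∞) (fun p : ((Fin m → ℝ) × (Fin k → ℝ)) × ℝ =>
      (p.1.1, vt p.1.2 p.2)) := by
    refine contDiff_fst.fst.prodMk (contDiff_pi.2 fun i => ?_)
    simp only [hvt]
    by_cases h : i ∈ T
    · simp only [h, if_true]; fun_prop
    · simp only [h, if_false]; fun_prop
  have hdf : ContDiff ℝ (⊤ : ℕ∞) (fderiv ℝ f) := hf.fderiv_right (by simp)
  have hdiff : Differentiable ℝ f := hf.differentiable (by simp)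
  have hG : ∀ i, ContDiff ℝ (⊤ : ℕ∞) (fun p : ((Fin m → ℝ) × (Fin k → ℝ)) × ℝ =>
      fderiv ℝ f (p.1.1, vt p.1.2 p.2) (0, Pi.single i 1)) := fun i =>
    (hdf.comp hvtc).clm_apply contDiff_const
  have hGt : ∀ i x v, Continuous (fun t : ℝ =>
      fderiv ℝ f (x, vt v t) (0, Pi.single i 1)) := fun i x v =>
    (hG i).continuous.comp (Continuous.prodMk_right (x, v))
  refine ⟨⟨fun i _ => ?_, fun x v => ?_⟩, ?_, ?_⟩
  · have hFi : F i = fun q => ∫ t in (0 : ℝ)..1,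
        fderiv ℝ f (q.1, vt q.2 t) (0, Pi.single i 1) := by
      funext q; exact hF i q.1 q.2
    rw [hFi]
    refine contDiff_infty.2 fun n => ?_
    exact aux_param n _ (contDiff_infty.1 (hG i) n)
  · let w : Fin k → ℝ := fun i => if i ∈ T then v i else 0
    have hw : ((0 : Fin m → ℝ), w) = ∑ i ∈ T, v i • ((0 : Fin m → ℝ), (Pi.single i 1 : Fin k → ℝ)) := by
      ext j
      · simp [Prod.fst_sum]
      · simp [Prod.snd_sum, w, Pi.single_apply]
    have hpath : ∀ t : ℝ, HasDerivAt (fun t => (x, vt v t)) ((0 : Fin m → ℝ), w) t := by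
      intro t
      refine (hasDerivAt_const t x).prodMk (hasDerivAt_pi.2 fun i => ?_)
      simp only [hvt, w]
      by_cases h : i ∈ T
      · simpa [h] using (hasDerivAt_id t).mul_const (v i)
      · simpa [h] using hasDerivAt_const t (v i)
    have hder : ∀ t : ℝ, HasDerivAt (fun t => f (x, vt v t))
        (∑ i ∈ T, v i * fderiv ℝ f (x, vt v t) (0, Pi.single i 1)) t := by
      intro t
      have := (hdiff (x, vt v t)).hasFDerivAt.comp_hasDerivAt t (hpath t)
      rw [hw, map_sum] at this
      simp only [map_smul, smul_eq_mul] at this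
      exact this
    have hint := intervalIntegral.integral_eq_sub_of_hasDerivAt (a := 0) (b := 1)
      (fun t _ => hder t) (Continuous.intervalIntegrable
        (continuous_finsetSum _ fun i _ => (hGt i x v).const_mul (v i)) _ _)
    have h1 : vt v 1 = v := by ext i; simp [hvt]
    have h0 : f (x, vt v 0) = 0 := hvan _ _ fun i hi => by simp [hvt, hi]
    rw [h1, h0, sub_zero, intervalIntegral.integral_finsetSum] at hint
    · rw [← hint]
      refine Finset.sum_congr rfl fun i _ => ?_
      rw [hF, intervalIntegral.integral_const_mul]
    · intro i _
      exact ((hGt i x v).const_mul (v i)).intervalIntegrable _ _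
  · intro T' i _ hiT' hvan' x v hv
    have hz : ∀ t : ℝ, fderiv ℝ f (x, vt v t) (0, Pi.single i 1) = 0 := by
      intro t
      have hl : HasDerivAt (fun s : ℝ => (x, vt v t) +
          s • ((0 : Fin m → ℝ), (Pi.single i 1 : Fin k → ℝ)))
          ((0 : Fin m → ℝ), (Pi.single i 1 : Fin k → ℝ)) 0 := by
        simpa using ((hasDerivAt_id (0 : ℝ)).smul_const
          ((0 : Fin m → ℝ), (Pi.single i 1 : Fin k → ℝ))).const_add (x, vt v t)
      have hc := (hdiff ((x, vt v t) + (0 : ℝ) •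
        ((0 : Fin m → ℝ), (Pi.single i 1 : Fin k → ℝ)))).hasFDerivAt.comp_hasDerivAt (0 : ℝ) hl
      have hzero : (f ∘ fun s : ℝ => (x, vt v t) +
          s • ((0 : Fin m → ℝ), (Pi.single i 1 : Fin k → ℝ))) = fun _ => 0 := by
        funext s
        refine hvan' _ _ fun l hl => ?_
        have hli : l ≠ i := fun h => hiT' (h ▸ hl)
        simp [hvt, hv l hl, hli]
      rw [hzero] at hc
      have := hc.unique (hasDerivAt_const (0 : ℝ) (0 : ℝ))
      simpa using this
    rw [hF]; simp [hz]
  · intro h i hi x v hv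
    have hz : ∀ t : ℝ, fderiv ℝ f (x, vt v t) (0, Pi.single i 1) = 0 := fun t =>
      h i hi _ _ fun l hl => by simp [hvt, hv l hl]
    rw [hF]; simp [hz]
end
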